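/- Suppose the action of the dihedral group on Coef·α_s + Coef·α_t is faithful; concretely, suppose that for every 1 ≤ k ≤ m−1 the endomorphism (s∘t)^k of the free Coef-module Coef·α_s ⊕ Coef·α_t is not the identity, where s and t are the Coef-linear involutions with s(α_s) = −α_s, s(α_t) = α_t + X·α_s, t(α_s) = α_s + Y·α_t, t(α_t) = −α_t. Then [m choose k]_Z = 0 for every 1 ≤ k ≤ m−1 and every Z ∈ {X,Y}. -/

import Mathlib

noncomputable section
namespace TCQ

/-- The polynomial ring `ℤ[X̃,Ỹ]` (`X̃` indexed by `true`, `Ỹ` by `false`). -/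
abbrev R₀ : Type := MvPolynomial Bool ℤ

/-- The generic two-colored quantum numbers `[n]_{X̃}, [n]_{Ỹ} ∈ ℤ[X̃,Ỹ]`
(color `true` = `X̃`, `false` = `Ỹ`). -/
def q : Bool → ℕ → R₀
  | _, 0 => 0
  | _, 1 => 1
  | c, (n + 2) => MvPolynomial.X c * q (!c) (n + 1) - q c n

/-- `binom` is the generic two-colored quantum binomial coefficient
`[m choose n]_Z = ([m]_Z [m−1]_Z ⋯ [m−n+1]_Z)/([n]_Z ⋯ [1]_Z) ∈ ℤ[X̃,Ỹ]`, i.e. it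
satisfies `[m choose n]_Z · ([n]_Z ⋯ [1]_Z) = [m]_Z ⋯ [m−n+1]_Z` for all `n ≤ m` (this
determines it uniquely, `ℤ[X̃,Ỹ]` being a domain and the quantum numbers nonzero). -/
def IsBinom (binom : Bool → ℕ → ℕ → R₀) : Prop :=
  ∀ (Z : Bool) (m n : ℕ), n ≤ m →
    binom Z m n * ∏ i ∈ Finset.range n, q Z (i + 1) = ∏ i ∈ Finset.range n, q Z (m - i)

variable {Coef : Type*} [CommRing Coef]

/-- The two-colored quantum numbers `[n]_X, [n]_Y ∈ Coef` attached to `X, Y ∈ Coef`: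
`[0]_Z = 0`, `[1]_Z = 1`, `[n+1]_Z = Z·[n]_{σ(Z)} − [n−1]_Z`
(color `true` = `X`, `false` = `Y`). -/
def qc (x y : Coef) : Bool → ℕ → Coef
  | _, 0 => 0
  | _, 1 => 1
  | c, (n + 2) => (if c then x else y) * qc x y (!c) (n + 1) - qc x y c n

/-- The ring homomorphism `ℤ[X̃,Ỹ] → Coef` sending `X̃ ↦ X`, `Ỹ ↦ Y`.  The two-colored
quantum binomial coefficient `[m choose n]_Z ∈ Coef` is the image of the generic one
under this map. -/
def toCoef (x y : Coef) : R₀ →+* Coef :=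
  MvPolynomial.eval₂Hom (Int.castRingHom Coef) (fun b => if b then x else y)

end TCQ
end

noncomputable section
namespace TCQ

variable {Coef : Type*} [CommRing Coef]

/-- The matrix of the `Coef`-linear involution `s` of `Coef·α_s ⊕ Coef·α_t` in the
basis `{α_s, α_t}` (`α_s` indexed by `true`, `α_t` by `false`):
`s(α_s) = −α_s`, `s(α_t) = α_t + X·α_s`. -/
def sMatC (x : Coef) : Matrix Bool Bool Coef :=
  Matrix.of fun i j =>
    match i, j with
    | true, true => -1
    | true, false => x
    | false, true => 0
    | false, false => 1

/-- The matrix of the `Coef`-linear involution `t` of `Coef·α_s ⊕ Coef·α_t` in the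
basis `{α_s, α_t}`: `t(α_s) = α_s + Y·α_t`, `t(α_t) = −α_t`. -/
def tMatC (y : Coef) : Matrix Bool Bool Coef :=
  Matrix.of fun i j =>
    match i, j with
    | true, true => 1
    | true, false => 0
    | false, true => y
    | false, false => -1

end TCQ
end

namespace TCQ

section Numbers

variable {R : Type*} [CommRing R]

theorem qc_parity (x y : R) (k : ℕ) :
    y * qc x y true (2 * k) = x * qc x y false (2 * k) ∧
      qc x y true (2 * k + 1) = qc x y false (2 * k + 1) := by
  induction k with
  | zero => simp [qc]
  | succ k ih =>
    obtain ⟨h₁, h₂⟩ := ih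
    have e : ∀ c, qc x y c (2 * (k + 1)) =
        (if c then x else y) * qc x y (!c) (2 * k + 1) - qc x y c (2 * k) := fun c => by
      rw [show 2 * (k + 1) = 2 * k + 2 by ring, qc]
    have o : ∀ c, qc x y c (2 * (k + 1) + 1) =
        (if c then x else y) * qc x y (!c) (2 * (k + 1)) - qc x y c (2 * k + 1) := fun c => by
      rw [show 2 * (k + 1) + 1 = (2 * k + 1) + 2 by ring, qc,
        show 2 * k + 1 + 1 = 2 * (k + 1) by ring]
    have h₃ : y * qc x y true (2 * (k + 1)) = x * qc x y false (2 * (k + 1)) := by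
      rw [e, e]
      simp only [Bool.not_true, Bool.not_false, if_true, Bool.false_eq_true, if_false]
      linear_combination -x * y * h₂ - h₁
    refine ⟨h₃, ?_⟩
    rw [o, o]
    simp only [Bool.not_true, Bool.not_false, if_true, Bool.false_eq_true, if_false]
    linear_combination -h₃ - h₂

theorem qc_consecutive_swap (x y : R) (n : ℕ) :
    y * (qc x y true n * qc x y true (n + 1)) =
      x * (qc x y false n * qc x y false (n + 1)) := by
  obtain ⟨k, rfl | rfl⟩ := Nat.even_or_odd' n
  · obtain ⟨h₁, h₂⟩ := qc_parity x y k
    rw [← mul_assoc, h₁, h₂, mul_assoc]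
  · have h₂ := (qc_parity x y k).2
    have h₁ := (qc_parity x y (k + 1)).1
    rw [show 2 * (k + 1) = 2 * k + 1 + 1 by ring] at h₁
    rw [mul_left_comm, h₁, h₂, mul_left_comm]

theorem qc_prod_swap (x y : R) (f : ℕ → ℕ) (j : ℕ)
    (hf : ∀ i < j, f (2 * i + 1) = f (2 * i) + 1 ∨ f (2 * i) = f (2 * i + 1) + 1) :
    y ^ j * ∏ i ∈ Finset.range (2 * j), qc x y true (f i) =
      x ^ j * ∏ i ∈ Finset.range (2 * j), qc x y false (f i) := by
  induction j with
  | zero => simp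
  | succ j ih =>
    have h₁ := ih fun i hi => hf i (by omega)
    have h₂ : y * (qc x y true (f (2 * j)) * qc x y true (f (2 * j + 1))) =
        x * (qc x y false (f (2 * j)) * qc x y false (f (2 * j + 1))) := by
      rcases hf j (by omega) with h | h
      · rw [h]
        exact qc_consecutive_swap x y _
      · rw [h, mul_comm (qc x y true _), mul_comm (qc x y false _)]
        exact qc_consecutive_swap x y _
    rw [show 2 * (j + 1) = 2 * j + 1 + 1 by ring]
    simp only [Finset.prod_range_succ, pow_succ]
    calc _ = (y ^ j * ∏ i ∈ Finset.range (2 * j), qc x y true (f i)) *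
          (y * (qc x y true (f (2 * j)) * qc x y true (f (2 * j + 1)))) := by ring
      _ = _ := by rw [h₁, h₂]; ring

theorem toCoef_q (x y : R) : ∀ (c : Bool) (n : ℕ), toCoef x y (q c n) = qc x y c n
  | _, 0 => by simp [q, qc]
  | _, 1 => by simp [q, qc]
  | c, n + 2 => by
    rw [q, qc, map_sub, map_mul, toCoef_q x y _ (n + 1), toCoef_q x y _ n]
    simp [toCoef]

theorem qc_two (c : Bool) : ∀ n : ℕ, qc (2 : ℤ) 2 c n = n
  | 0 => by simp [qc]
  | 1 => by simp [qc]
  | n + 2 => by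
    rw [qc, qc_two _ (n + 1), qc_two _ n]
    push_cast
    split_ifs <;> ring

theorem q_ne_zero (c : Bool) {n : ℕ} (hn : n ≠ 0) : q c n ≠ 0 := by
  intro h
  have := toCoef_q (2 : ℤ) 2 c n
  rw [h, map_zero, qc_two] at this
  exact hn (by exact_mod_cast this.symm)

theorem q_eq_qc : ∀ (c : Bool) (n : ℕ),
    q c n = qc (MvPolynomial.X true : R₀) (MvPolynomial.X false) c n
  | _, 0 => by simp [q, qc]
  | _, 1 => by simp [q, qc]
  | c, n + 2 => by
    rw [q, qc, q_eq_qc _ (n + 1), q_eq_qc _ n]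
    cases c <;> simp

end Numbers

section Binomials

theorem IsBinom.swap_of_even {binom : Bool → ℕ → ℕ → R₀} (h : IsBinom binom) {m j : ℕ}
    (hj : 2 * j ≤ m) : binom true m (2 * j) = binom false m (2 * j) := by
  have ht := h true m (2 * j) hj
  have hf := h false m (2 * j) hj
  have hP := qc_prod_swap (MvPolynomial.X true : R₀) (MvPolynomial.X false) (fun i => i + 1) j
    fun i _ => Or.inl rfl
  have hN := qc_prod_swap (MvPolynomial.X true : R₀) (MvPolynomial.X false) (fun i => m - i) j
    fun i hi => Or.inr (by omega)
  simp only [← q_eq_qc] at hP hN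
  have hne : (MvPolynomial.X false : R₀) ^ j * ∏ i ∈ Finset.range (2 * j), q true (i + 1) ≠ 0 :=
    mul_ne_zero (pow_ne_zero _ (MvPolynomial.X_ne_zero _))
      (Finset.prod_ne_zero_iff.2 fun i _ => q_ne_zero _ i.succ_ne_zero)
  apply mul_right_cancel₀ hne
  linear_combination (MvPolynomial.X false : R₀) ^ j * ht + hN -
    (MvPolynomial.X true : R₀) ^ j * hf - binom false m (2 * j) * hP

theorem IsBinom.absorption {binom : Bool → ℕ → ℕ → R₀} (h : IsBinom binom) (Z : Bool)
    {m k : ℕ} (hk : k ≤ m) :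
    binom Z (m + 1) (k + 1) * q Z (k + 1) = q Z (m + 1) * binom Z m k := by
  have h₁ := h Z (m + 1) (k + 1) (by omega)
  have h₂ := h Z m k hk
  rw [Finset.prod_range_succ, Finset.prod_range_succ'] at h₁
  simp only [Nat.add_sub_add_right, Nat.sub_zero] at h₁
  have hne : ∏ i ∈ Finset.range k, q Z (i + 1) ≠ 0 :=
    Finset.prod_ne_zero_iff.2 fun i _ => q_ne_zero _ i.succ_ne_zero
  apply mul_right_cancel₀ hne
  linear_combination h₁ - q Z (m + 1) * h₂

theorem IsBinom.toCoef_eq_zero {R : Type*} [CommRing R] [IsDomain R] {x y : R}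
    {binom : Bool → ℕ → ℕ → R₀} (h : IsBinom binom) {Z : Bool} {m k : ℕ} (hk : 1 ≤ k)
    (hkm : k ≤ m) (hm : qc x y Z m = 0) (hne : qc x y Z k ≠ 0) :
    toCoef x y (binom Z m k) = 0 := by
  obtain ⟨k, rfl⟩ := Nat.exists_eq_add_of_le' hk
  obtain ⟨m, rfl⟩ := Nat.exists_eq_add_of_le' (hk.trans hkm)
  have := congrArg (toCoef x y) (h.absorption Z (m := m) (k := k) (by omega))
  rw [map_mul, map_mul, toCoef_q, toCoef_q, hm, zero_mul] at this
  exact (mul_eq_zero.1 this).resolve_right hne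

end Binomials

section Rotation

variable {R : Type*} [CommRing R] (x y : R)

theorem sMatC_mul_tMatC_pow (k : ℕ) :
    (sMatC x * tMatC y) ^ k = Matrix.of fun i j =>
      match i, j with
      | true, true => qc x y true (2 * k + 1)
      | true, false => -qc x y true (2 * k)
      | false, true => qc x y false (2 * k)
      | false, false => qc x y true (2 * k + 1) - x * qc x y false (2 * k) := by
  induction k with
  | zero =>
    ext i j
    cases i <;> cases j <;> simp [qc]
  | succ k ih =>
    obtain ⟨h₁, h₂⟩ := qc_parity x y k
    rw [pow_succ, ih, show 2 * (k + 1) = 2 * k + 2 by ring]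
    ext i j
    cases i <;> cases j <;>
      simp [Matrix.mul_apply, sMatC, tMatC, qc, ← h₂] <;>
      first | ring1 | linear_combination h₁ | linear_combination -h₁

theorem qc_det (k : ℕ) :
    qc x y true (2 * k + 1) * (qc x y true (2 * k + 1) - x * qc x y false (2 * k)) +
      qc x y true (2 * k) * qc x y false (2 * k) = 1 := by
  induction k with
  | zero => simp [qc]
  | succ k ih =>
    obtain ⟨h₁, h₂⟩ := qc_parity x y k
    rw [show 2 * (k + 1) = 2 * k + 2 by ring]
    simp only [qc, Bool.not_true, Bool.not_false, if_true, Bool.false_eq_true, if_false, ← h₂]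
    linear_combination ih - qc x y true (2 * k + 1) * h₁

theorem sMatC_mul_tMatC_pow_eq_one {n : ℕ} (ht : qc x y true n = 0) (hf : qc x y false n = 0) :
    (sMatC x * tMatC y) ^ n = 1 := by
  obtain ⟨k, rfl | rfl⟩ := Nat.even_or_odd' n
  · have hd := qc_det x y k
    rw [two_mul, pow_add, sMatC_mul_tMatC_pow]
    rw [ht, hf] at hd
    ext i j
    cases i <;> cases j <;> simp [Matrix.mul_apply, ht, hf] <;> linear_combination hd
  · have hd := qc_det x y k
    rw [show 2 * k + 1 = k + (k + 1) by ring, pow_add, sMatC_mul_tMatC_pow, sMatC_mul_tMatC_pow,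
      show 2 * (k + 1) = 2 * k + 2 by ring]
    rw [ht] at hd
    ext i j
    cases i <;> cases j <;> simp [Matrix.mul_apply, qc, ht, hf] <;> first | ring1 | linear_combination hd

end Rotation

end TCQ

open TCQ in
/-- let `Coef` be an integral domain, `X, Y ∈ Coef`, `m ≥ 2`, and assume
`[m]_X = [m]_Y = 0`.  Suppose the action of the dihedral group on
`Coef·α_s + Coef·α_t` is faithful, i.e. `(s∘t)^k` is not the identity for any
`1 ≤ k ≤ m−1`.  Then `[m choose k]_Z = 0` for every `1 ≤ k ≤ m−1` and `Z ∈ {X,Y}`. -/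
theorem tcq_binom_vanishing_of_faithful {Coef : Type*} [CommRing Coef] [IsDomain Coef]
    (x y : Coef) (m : ℕ) (hm : 2 ≤ m)
    (hmx : qc x y true m = 0) (hmy : qc x y false m = 0)
    (gbinom : Bool → ℕ → ℕ → TCQ.R₀) (hgbinom : IsBinom gbinom)
    (hfaithful : ∀ k, 1 ≤ k → k ≤ m - 1 → (sMatC x * tMatC y) ^ k ≠ 1) :
    ∀ k, 1 ≤ k → k ≤ m - 1 → ∀ Z : Bool, toCoef x y (gbinom Z m k) = 0 := by
  intro k hk hkm Z
  have hm0 : ∀ Z, qc x y Z m = 0 := by simp [hmx, hmy]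
  have hkm' : k ≤ m := by omega
  by_cases hZ : qc x y Z k = 0
  · have hnZ : qc x y (!Z) k ≠ 0 := by
      intro h
      apply hfaithful k hk hkm
      cases Z
      · exact sMatC_mul_tMatC_pow_eq_one x y h hZ
      · exact sMatC_mul_tMatC_pow_eq_one x y hZ h
    have hvanish := hgbinom.toCoef_eq_zero hk hkm' (hm0 _) hnZ
    obtain ⟨j, rfl | rfl⟩ := Nat.even_or_odd' k
    · have hswap := hgbinom.swap_of_even hkm'
      cases Z
      · exact hswap ▸ hvanish
      · exact hswap ▸ hvanish
    · have hodd := (qc_parity x y j).2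
      cases Z
      · exact absurd (hodd.trans hZ) hnZ
      · exact absurd (hodd.symm.trans hZ) hnZ
  · exact hgbinom.toCoef_eq_zero hk hkm' (hm0 Z) hZ
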